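/- arXiv:1609.08592 — 3 statements merged into one kernel-verified Lean document; each statement's English description precedes it below -/
import Mathlib

section
/- (Holevo-quantity upper bound for ensembles of pure tripartite states.) Let ι_B, ι_E, ι_R and X be finite types, let p : X → ℝ satisfy p_x ≥ 0 and ∑_x p_x = 1, and for each x ∈ X let Φ_x ∈ ℂ^{ι_B × ι_E × ι_R} be a unit vector with pure density matrix π_x = Φ_x Φ_xᴴ. Let ρ_{BE}^{(x)} and ρ_R^{(x)} be the reduced density matrices of π_x on B×E and on R respectively, let ρ̄_{BE} = ∑_x p_x ρ_{BE}^{(x)}, and let ρ̄_B and ρ̄_E be the marginals of ρ̄_{BE}. Then the Holevo quantity of the ensemble satisfies S(ρ̄_{BE}) − ∑_x p_x S(ρ_{BE}^{(x)}) ≤ S(ρ̄_B) + S(ρ̄_E) − ∑_x p_x S(ρ_R^{(x)}). Moreover, if ρ̄_{BE} = ρ̄_B ⊗ ρ̄_E then equality holds. -/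
open Matrix Kronecker BigOperators ComplexOrder

noncomputable section

/-- Von Neumann entropy of a (Hermitian) matrix: `∑ i, negMulLog (λ i)`. -/
noncomputable def vnEntropy {ι : Type*} [Fintype ι] [DecidableEq ι] (ρ : Matrix ι ι ℂ) : ℝ :=
  if h : ρ.IsHermitian then ∑ i, Real.negMulLog (h.eigenvalues i) else 0

theorem vnEntropy_eq_sum_roots {ι : Type*} [Fintype ι] [DecidableEq ι] {A : Matrix ι ι ℂ}
    (hA : A.IsHermitian) :
    vnEntropy A = (A.charpoly.roots.map fun z => Real.negMulLog z.re).sum := by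
  rw [vnEntropy, dif_pos hA, hA.roots_charpoly_eq_eigenvalues, Multiset.map_map]
  simp

theorem vnEntropy_eq_of_charpoly_eq {ι : Type*} [Fintype ι] [DecidableEq ι] {A B : Matrix ι ι ℂ}
    (hA : A.IsHermitian) (hB : B.IsHermitian) (h : A.charpoly = B.charpoly) :
    vnEntropy A = vnEntropy B := by
  rw [vnEntropy_eq_sum_roots hA, vnEntropy_eq_sum_roots hB, h]

theorem vnEntropy_diagonal {ι : Type*} [Fintype ι] [DecidableEq ι] (d : ι → ℝ) :
    vnEntropy (diagonal fun i => (d i : ℂ)) = ∑ i, Real.negMulLog (d i) := by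
  rw [vnEntropy_eq_sum_roots (isHermitian_diagonal_of_self_adjoint _ (by ext i; simp)),
    charpoly_diagonal, Polynomial.roots_prod _ _
      (Finset.prod_ne_zero_iff.2 fun i _ => Polynomial.X_sub_C_ne_zero _)]
  simp

theorem vnEntropy_transpose {ι : Type*} [Fintype ι] [DecidableEq ι] {A : Matrix ι ι ℂ}
    (hA : A.IsHermitian) : vnEntropy Aᵀ = vnEntropy A :=
  vnEntropy_eq_of_charpoly_eq hA.transpose hA (charpoly_transpose A)

theorem vnEntropy_unitary_conj {ι : Type*} [Fintype ι] [DecidableEq ι] {A : Matrix ι ι ℂ}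
    (hA : A.IsHermitian) {U : Matrix ι ι ℂ} (hU : U * Uᴴ = 1) :
    vnEntropy (Uᴴ * A * U) = vnEntropy A := by
  refine vnEntropy_eq_of_charpoly_eq (isHermitian_conjTranspose_mul_mul U hA) hA ?_
  rw [charpoly_mul_comm, ← mul_assoc, hU, one_mul]

open Polynomial in
/-- The two Gram matrices of a rectangular matrix have the same entropy. -/
theorem vnEntropy_mul_conjTranspose_self {m n : Type*} [Fintype m] [DecidableEq m] [Fintype n]
    [DecidableEq n] (M : Matrix m n ℂ) : vnEntropy (M * Mᴴ) = vnEntropy (Mᴴ * M) := by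
  rw [vnEntropy_eq_sum_roots (isHermitian_mul_conjTranspose_self M),
    vnEntropy_eq_sum_roots (isHermitian_conjTranspose_mul_self M)]
  have hroots (k : ℕ) {q : ℂ[X]} (hq : q.Monic) :
      ((X ^ k * q).roots.map fun z : ℂ => Real.negMulLog z.re).sum =
        (q.roots.map fun z => Real.negMulLog z.re).sum := by
    rw [roots_mul ((monic_X_pow k).mul hq).ne_zero]
    simp [Multiset.map_nsmul, Multiset.sum_nsmul]
  rw [← hroots (Fintype.card n) (charpoly_monic _), charpoly_mul_comm',
    hroots _ (charpoly_monic _)]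

/-- The entropy of a positive semidefinite matrix is at most the Shannon entropy of its
diagonal. -/
theorem vnEntropy_le_sum_diag {ι : Type*} [Fintype ι] [DecidableEq ι] {A : Matrix ι ι ℂ}
    (hA : A.PosSemidef) : vnEntropy A ≤ ∑ i, Real.negMulLog (A i i).re := by
  have hH := hA.isHermitian
  set U : Matrix ι ι ℂ := (hH.eigenvectorUnitary : Matrix ι ι ℂ) with hU
  have hU1 : U * Uᴴ = 1 := Unitary.coe_mul_star_self hH.eigenvectorUnitary
  have hU2 : Uᴴ * U = 1 := Unitary.coe_star_mul_self hH.eigenvectorUnitary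
  have hrow (i : ι) : ∑ k, Complex.normSq (U i k) = 1 := by
    have := congrFun (congrFun hU1 i) i
    simp only [mul_apply, conjTranspose_apply, one_apply_eq, RCLike.star_def,
      Complex.mul_conj] at this
    exact_mod_cast this
  have hcol (k : ι) : ∑ i, Complex.normSq (U i k) = 1 := by
    have := congrFun (congrFun hU2 k) k
    simp only [mul_apply, conjTranspose_apply, one_apply_eq, RCLike.star_def,
      ← Complex.normSq_eq_conj_mul_self] at this
    exact_mod_cast this
  have hdiag (i : ι) : (A i i).re = ∑ k, Complex.normSq (U i k) * hH.eigenvalues k := by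
    have hs : A = U * diagonal (fun k => (hH.eigenvalues k : ℂ)) * Uᴴ := hH.spectral_theorem
    have : A i i = ((∑ k, Complex.normSq (U i k) * hH.eigenvalues k : ℝ) : ℂ) := by
      conv_lhs => rw [hs]
      simp only [Matrix.mul_apply (N := Uᴴ), mul_diagonal, conjTranspose_apply, RCLike.star_def]
      push_cast
      refine Finset.sum_congr rfl fun k _ => ?_
      rw [← Complex.mul_conj]
      ring
    rw [this, Complex.ofReal_re]
  calc vnEntropy A = ∑ k, Real.negMulLog (hH.eigenvalues k) := by rw [vnEntropy, dif_pos hH]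
    _ = ∑ i, ∑ k, Complex.normSq (U i k) * Real.negMulLog (hH.eigenvalues k) := by
      rw [Finset.sum_comm]
      simp_rw [← Finset.sum_mul, hcol, one_mul]
    _ ≤ ∑ i, Real.negMulLog (A i i).re := by
      refine Finset.sum_le_sum fun i _ => ?_
      rw [hdiag]
      exact Real.concaveOn_negMulLog.le_map_sum (fun k _ => Complex.normSq_nonneg _) (hrow i)
        (fun k _ => hA.eigenvalues_nonneg k)

/-- Klein's inequality for real numbers. -/
theorem negMulLog_le_sub_mul_log {x y : ℝ} (hx : 0 ≤ x) (hy : 0 ≤ y) (hxy : y = 0 → x = 0) :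
    Real.negMulLog x ≤ y - x - x * Real.log y := by
  rcases hx.eq_or_lt with rfl | hx
  · simpa using hy
  have hy' : 0 < y := hy.lt_of_ne fun h => hx.ne' (hxy h.symm)
  have h := Real.log_le_sub_one_of_pos (div_pos hy' hx)
  rw [Real.log_div hy'.ne' hx.ne'] at h
  have h' := mul_le_mul_of_nonneg_left h hx.le
  have e : x * (y / x - 1) = y - x := by field_simp
  rw [e] at h'
  rw [Real.negMulLog]
  linarith

/-- Subadditivity of the Shannon entropy. -/
theorem sum_negMulLog_le_add {m n : Type*} [Fintype m] [Fintype n] (P : m → n → ℝ)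
    (hP : ∀ i j, 0 ≤ P i j) (h1 : ∑ i, ∑ j, P i j = 1) :
    ∑ i, ∑ j, Real.negMulLog (P i j) ≤
      ∑ i, Real.negMulLog (∑ j, P i j) + ∑ j, Real.negMulLog (∑ i, P i j) := by
  set a : m → ℝ := fun i => ∑ j, P i j with ha
  set b : n → ℝ := fun j => ∑ i, P i j with hb
  have ha0 (i) : 0 ≤ a i := Finset.sum_nonneg fun j _ => hP i j
  have hb0 (j) : 0 ≤ b j := Finset.sum_nonneg fun i _ => hP i j
  have haP (i j) (h : a i = 0) : P i j = 0 :=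
    (Finset.sum_eq_zero_iff_of_nonneg fun j _ => hP i j).1 h j (Finset.mem_univ j)
  have hbP (i j) (h : b j = 0) : P i j = 0 :=
    (Finset.sum_eq_zero_iff_of_nonneg fun i _ => hP i j).1 h i (Finset.mem_univ i)
  have hb1 : ∑ j, b j = 1 := by rw [hb, Finset.sum_comm]; exact h1
  have key (i j) : Real.negMulLog (P i j) ≤
      a i * b j - P i j - (P i j * Real.log (a i) + P i j * Real.log (b j)) := by
    have h := negMulLog_le_sub_mul_log (hP i j) (mul_nonneg (ha0 i) (hb0 j))
      fun h => (mul_eq_zero.1 h).elim (haP i j) (hbP i j)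
    by_cases hp : P i j = 0
    · simpa [hp] using mul_nonneg (ha0 i) (hb0 j)
    · rwa [Real.log_mul (fun h => hp (haP i j h)) (fun h => hp (hbP i j h)), mul_add] at h
  refine (Finset.sum_le_sum fun i _ => Finset.sum_le_sum fun j _ => key i j).trans_eq ?_
  simp only [Finset.sum_sub_distrib, Finset.sum_add_distrib]
  have e1 : ∑ i, ∑ j, a i * b j = 1 := by
    simp_rw [← Finset.mul_sum, hb1, mul_one]
    exact h1
  have e2 : ∑ i, ∑ j, P i j * Real.log (a i) = -∑ i, Real.negMulLog (a i) := by
    simp_rw [← Finset.sum_mul, Real.negMulLog, neg_mul, Finset.sum_neg_distrib, neg_neg, ha]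
  have e3 : ∑ i, ∑ j, P i j * Real.log (b j) = -∑ j, Real.negMulLog (b j) := by
    rw [Finset.sum_comm]
    simp_rw [← Finset.sum_mul, Real.negMulLog, neg_mul, Finset.sum_neg_distrib, neg_neg, hb]
  rw [e1, h1, e2, e3]
  ring

/-- Partial trace over the second tensor factor. -/
def traceRight {m n : Type*} [Fintype n] (A : Matrix (m × n) (m × n) ℂ) : Matrix m m ℂ :=
  of fun i i' => ∑ j, A (i, j) (i', j)

/-- Partial trace over the first tensor factor. -/
def traceLeft {m n : Type*} [Fintype m] (A : Matrix (m × n) (m × n) ℂ) : Matrix n n ℂ :=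
  of fun j j' => ∑ i, A (i, j) (i, j')

theorem traceRight_conj {m n : Type*} [Fintype m] [Fintype n] [DecidableEq n]
    (A : Matrix (m × n) (m × n) ℂ) (U : Matrix m m ℂ) {V : Matrix n n ℂ} (hV : V * Vᴴ = 1) :
    traceRight ((U ⊗ₖ V)ᴴ * A * (U ⊗ₖ V)) = Uᴴ * traceRight A * U := by
  ext i i'
  have hV' (e e' : n) : ∑ j, V e' j * star (V e j) = if e' = e then 1 else 0 := by
    simpa [mul_apply, one_apply] using congrFun (congrFun hV e') e
  simp only [traceRight, of_apply, mul_apply, conjTranspose_apply, kroneckerMap_apply,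
    Finset.sum_mul, Finset.mul_sum, star_mul']
  calc _ = ∑ y : m × n, ∑ x : m × n, star (U x.1 i) * A x y * U y.1 i' *
        ∑ j, V y.2 j * star (V x.2 j) := by
        simp only [Finset.mul_sum]
        rw [Finset.sum_comm]
        refine Finset.sum_congr rfl fun y _ => ?_
        rw [Finset.sum_comm]
        refine Finset.sum_congr rfl fun x _ => Finset.sum_congr rfl fun j _ => ?_
        ring
    _ = _ := by
        simp only [hV', mul_ite, mul_one, mul_zero, Fintype.sum_prod_type, Finset.sum_ite_eq,
          Finset.mem_univ, if_true]
        exact Finset.sum_congr rfl fun b' _ => Finset.sum_comm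

theorem traceLeft_conj {m n : Type*} [Fintype m] [DecidableEq m] [Fintype n]
    (A : Matrix (m × n) (m × n) ℂ) {U : Matrix m m ℂ} (V : Matrix n n ℂ) (hU : U * Uᴴ = 1) :
    traceLeft ((U ⊗ₖ V)ᴴ * A * (U ⊗ₖ V)) = Vᴴ * traceLeft A * V := by
  have h := traceRight_conj (A.submatrix Prod.swap Prod.swap) V hU
  have hK : V ⊗ₖ U = (U ⊗ₖ V).submatrix Prod.swap Prod.swap := by
    ext; simp [mul_comm]
  have hs : Function.Bijective (Prod.swap : n × m → m × n) := Prod.swap_bijective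
  rw [hK, conjTranspose_submatrix, submatrix_mul _ _ _ _ _ hs |>.symm,
    submatrix_mul _ _ _ _ _ hs |>.symm] at h
  exact h

theorem exists_unitary_diagonalizing {ι : Type*} [Fintype ι] [DecidableEq ι] {A : Matrix ι ι ℂ}
    (hA : A.IsHermitian) : ∃ (U : Matrix ι ι ℂ) (d : ι → ℝ), U * Uᴴ = 1 ∧
      Uᴴ * A * U = diagonal (fun i => (d i : ℂ)) ∧
      vnEntropy A = ∑ i, Real.negMulLog (d i) := by
  have hU := Unitary.coe_mul_star_self hA.eigenvectorUnitary
  refine ⟨hA.eigenvectorUnitary, hA.eigenvalues, hU, ?_, by rw [vnEntropy, dif_pos hA]⟩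
  simpa [Unitary.conjStarAlgAut_star_apply] using! hA.conjStarAlgAut_star_eigenvectorUnitary

theorem Matrix.IsHermitian.traceRight {m n : Type*} [Fintype n] {A : Matrix (m × n) (m × n) ℂ}
    (hA : A.IsHermitian) : (traceRight A).IsHermitian := by
  ext i i'
  simp only [_root_.traceRight, conjTranspose_apply, of_apply, star_sum, hA.apply]

theorem Matrix.IsHermitian.traceLeft {m n : Type*} [Fintype m] {A : Matrix (m × n) (m × n) ℂ}
    (hA : A.IsHermitian) : (traceLeft A).IsHermitian := by
  ext i i'
  simp only [_root_.traceLeft, conjTranspose_apply, of_apply, star_sum, hA.apply]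

/-- Subadditivity of the von Neumann entropy. -/
theorem vnEntropy_le_traceRight_add_traceLeft {m n : Type*} [Fintype m] [DecidableEq m]
    [Fintype n] [DecidableEq n] {A : Matrix (m × n) (m × n) ℂ} (hA : A.PosSemidef)
    (hA1 : A.trace = 1) :
    vnEntropy A ≤ vnEntropy (traceRight A) + vnEntropy (traceLeft A) := by
  obtain ⟨U, a, hU, hUa, ha⟩ := exists_unitary_diagonalizing hA.isHermitian.traceRight
  obtain ⟨V, b, hV, hVb, hb⟩ := exists_unitary_diagonalizing hA.isHermitian.traceLeft
  have hW : (U ⊗ₖ V) * (U ⊗ₖ V)ᴴ = 1 := by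
    rw [conjTranspose_kronecker, ← mul_kronecker_mul, hU, hV, one_kronecker_one]
  set B := (U ⊗ₖ V)ᴴ * A * (U ⊗ₖ V) with hB
  have hBpos : B.PosSemidef := hA.conjTranspose_mul_mul_same _
  have hBa (i : m) : ∑ j, (B (i, j) (i, j)).re = a i := by
    have := congrFun (congrFun ((traceRight_conj A U hV).trans hUa) i) i
    simpa [traceRight] using congrArg Complex.re this
  have hBb (j : n) : ∑ i, (B (i, j) (i, j)).re = b j := by
    have := congrFun (congrFun ((traceLeft_conj A V hU).trans hVb) j) j
    simpa [traceLeft] using congrArg Complex.re this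
  have hB1 : ∑ i, ∑ j, (B (i, j) (i, j)).re = 1 := by
    have : B.trace = 1 := by rw [hB, trace_mul_comm, ← mul_assoc, hW, one_mul, hA1]
    simpa [trace, Fintype.sum_prod_type] using congrArg Complex.re this
  have hsub := sum_negMulLog_le_add (fun i j => (B (i, j) (i, j)).re)
    (fun i j => (Complex.nonneg_iff.1 hBpos.diag_nonneg).1) hB1
  simp_rw [hBa, hBb] at hsub
  calc vnEntropy A = vnEntropy B := (vnEntropy_unitary_conj hA.isHermitian hW).symm
    _ ≤ _ := vnEntropy_le_sum_diag hBpos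
    _ ≤ _ := by rwa [Fintype.sum_prod_type, ha, hb]

/-- The von Neumann entropy is additive on tensor products of trace-one matrices. -/
theorem vnEntropy_kronecker {m n : Type*} [Fintype m] [DecidableEq m]
    [Fintype n] [DecidableEq n] {A : Matrix m m ℂ} {B : Matrix n n ℂ} (hA : A.IsHermitian)
    (hB : B.IsHermitian) (hA1 : A.trace = 1) (hB1 : B.trace = 1) :
    vnEntropy (A ⊗ₖ B) = vnEntropy A + vnEntropy B := by
  obtain ⟨U, a, hU, hUa, ha⟩ := exists_unitary_diagonalizing hA
  obtain ⟨V, b, hV, hVb, hb⟩ := exists_unitary_diagonalizing hB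
  have hW : (U ⊗ₖ V) * (U ⊗ₖ V)ᴴ = 1 := by
    rw [conjTranspose_kronecker, ← mul_kronecker_mul, hU, hV, one_kronecker_one]
  have hsa : ∑ i, a i = 1 := by
    have h : (diagonal fun i => (a i : ℂ)).trace = 1 := by
      rw [← hUa, trace_mul_comm, ← mul_assoc, hU, one_mul, hA1]
    rw [trace_diagonal] at h
    exact_mod_cast h
  have hsb : ∑ i, b i = 1 := by
    have h : (diagonal fun i => (b i : ℂ)).trace = 1 := by
      rw [← hVb, trace_mul_comm, ← mul_assoc, hV, one_mul, hB1]
    rw [trace_diagonal] at h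
    exact_mod_cast h
  have hAB : (A ⊗ₖ B).IsHermitian := by
    rw [IsHermitian, conjTranspose_kronecker, hA.eq, hB.eq]
  have hd : (U ⊗ₖ V)ᴴ * (A ⊗ₖ B) * (U ⊗ₖ V) =
      diagonal (fun x : m × n => ((a x.1 * b x.2 : ℝ) : ℂ)) := by
    rw [conjTranspose_kronecker, ← mul_kronecker_mul, ← mul_kronecker_mul, hUa, hVb,
      diagonal_kronecker_diagonal]
    simp
  rw [← vnEntropy_unitary_conj hAB hW, hd, vnEntropy_diagonal, Fintype.sum_prod_type, ha, hb]
  simp_rw [Real.negMulLog_mul, Finset.sum_add_distrib, ← Finset.sum_mul, ← Finset.mul_sum,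
    ← Finset.sum_mul, hsa, hsb, one_mul]

/-- Holevo-quantity upper bound for an ensemble of pure tripartite states:
`S(ρ̄_BE) − ∑ p_x S(ρ_BE^x) ≤ S(ρ̄_B) + S(ρ̄_E) − ∑ p_x S(ρ_R^x)`, with equality when
`ρ̄_BE = ρ̄_B ⊗ ρ̄_E`. -/
theorem stmt10 {ιB ιE ιR X : Type*}
    [Fintype ιB] [DecidableEq ιB] [Fintype ιE] [DecidableEq ιE]
    [Fintype ιR] [DecidableEq ιR] [Fintype X]
    (p : X → ℝ) (hp : ∀ x, 0 ≤ p x) (hps : ∑ x, p x = 1)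
    (Φ : X → (ιB × ιE × ιR) → ℂ) (hΦ : ∀ x, ∑ i, ‖Φ x i‖ ^ 2 = 1)
    (π : X → Matrix (ιB × ιE × ιR) (ιB × ιE × ιR) ℂ)
    (hπ : ∀ x, π x = Matrix.vecMulVec (Φ x) (star (Φ x)))
    (ρBE : X → Matrix (ιB × ιE) (ιB × ιE) ℂ)
    (hρBE : ∀ x, ρBE x = fun u v => ∑ r, π x (u.1, (u.2, r)) (v.1, (v.2, r)))
    (ρR : X → Matrix ιR ιR ℂ)
    (hρR : ∀ x, ρR x = fun r r' => ∑ b, ∑ e, π x (b, (e, r)) (b, (e, r')))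
    (ρbarBE : Matrix (ιB × ιE) (ιB × ιE) ℂ)
    (hbar : ρbarBE = ∑ x, (p x : ℂ) • ρBE x)
    (ρbarB : Matrix ιB ιB ℂ)
    (hbarB : ρbarB = fun b b' => ∑ e, ρbarBE (b, e) (b', e))
    (ρbarE : Matrix ιE ιE ℂ)
    (hbarE : ρbarE = fun e e' => ∑ b, ρbarBE (b, e) (b, e')) :
    (vnEntropy ρbarBE - ∑ x, p x * vnEntropy (ρBE x) ≤
      vnEntropy ρbarB + vnEntropy ρbarE - ∑ x, p x * vnEntropy (ρR x)) ∧
    (ρbarBE = ρbarB ⊗ₖ ρbarE →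
      vnEntropy ρbarBE - ∑ x, p x * vnEntropy (ρBE x) =
        vnEntropy ρbarB + vnEntropy ρbarE - ∑ x, p x * vnEntropy (ρR x)) := by
  have hgram (x : X) : vnEntropy (ρBE x) = vnEntropy (ρR x) ∧ (ρBE x).PosSemidef ∧
      (ρBE x).trace = 1 := by
    let M : Matrix (ιB × ιE) ιR ℂ := of fun u r => Φ x (u.1, (u.2, r))
    have h1 : ρBE x = M * Mᴴ := by
      ext u v
      simp [hρBE, hπ, M, mul_apply, vecMulVec_apply]
    have h2 : ρR x = (Mᴴ * M)ᵀ := by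
      ext r r'
      simp [hρR, hπ, M, mul_apply, vecMulVec_apply, Fintype.sum_prod_type, mul_comm]
    refine ⟨?_, h1 ▸ posSemidef_self_mul_conjTranspose M, ?_⟩
    · rw [h1, h2, vnEntropy_transpose (isHermitian_conjTranspose_mul_self M),
        vnEntropy_mul_conjTranspose_self]
    · have h := congrArg (fun t : ℝ => (t : ℂ)) (hΦ x)
      simp only [Fintype.sum_prod_type] at h
      push_cast at h
      simpa [h1, M, trace, mul_apply, Fintype.sum_prod_type, Complex.mul_conj'] using h
  have hpos : ρbarBE.PosSemidef := by
    rw [hbar]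
    exact posSemidef_sum _ fun x _ => (hgram x).2.1.smul (by exact_mod_cast hp x)
  have htr : ρbarBE.trace = 1 := by
    simp only [hbar, trace_sum, trace_smul, (hgram _).2.2, smul_eq_mul, mul_one]
    exact_mod_cast hps
  have hB : ρbarB = traceRight ρbarBE := hbarB
  have hE : ρbarE = traceLeft ρbarBE := hbarE
  simp_rw [(hgram _).1]
  refine ⟨?_, fun hprod => ?_⟩
  · have := vnEntropy_le_traceRight_add_traceLeft hpos htr
    rw [hB, hE]
    linarith
  · have hB1 : ρbarB.trace = 1 := by
      rw [← htr, hB]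
      simp only [trace, traceRight, diag_apply, of_apply, Fintype.sum_prod_type]
    have hE1 : ρbarE.trace = 1 := by
      rw [← htr, hE]
      simp only [trace, traceLeft, diag_apply, of_apply, Fintype.sum_prod_type]
      exact Finset.sum_comm
    rw [hprod, vnEntropy_kronecker (hB ▸ hpos.isHermitian.traceRight)
      (hE ▸ hpos.isHermitian.traceLeft) hB1 hE1]
end
end

section
/- (Entropy of the output of an erasure channel.) Let 0 ≤ ε ≤ 1, let ι_A and ι_B be finite types, and let ρ be a density matrix on ι_A × ι_B with marginal ρ_B on ι_B. Define the matrix σ on the index type (Option ι_A) × ι_B (the erasure channel with erasure probability ε applied to the A system, with erasure flag 'none') by σ((some a, b),(some a', b')) = (1−ε)·ρ((a,b),(a',b')), σ((none, b),(none, b')) = ε·(ρ_B)(b,b'), and σ = 0 on all entries mixing 'some' and 'none'. Then σ is a density matrix and S(σ) = H(ε) + (1−ε)·S(ρ) + ε·S(ρ_B), where H(ε) = negMulLog(ε) + negMulLog(1−ε) is the binary entropy. -/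
open Matrix Kronecker BigOperators ComplexOrder

noncomputable section

/-- A density matrix: positive semidefinite with unit trace. -/
def IsDensityMatrix {ι : Type*} [Fintype ι] (ρ : Matrix ι ι ℂ) : Prop :=
  ρ.PosSemidef ∧ ρ.trace = 1

/-- Partial trace over the first tensor factor. -/
def ptraceFst {ιA ιB : Type*} [Fintype ιA] (ρ : Matrix (ιA × ιB) (ιA × ιB) ℂ) :
    Matrix ιB ιB ℂ :=
  fun b b' => ∑ a, ρ (a, b) (a, b')

/-- The output of the erasure channel (erasure probability `ε`, erasure flag `none`)
applied to the `A` share of a bipartite state. -/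
noncomputable def erasureOut {ιA ιB : Type*} [Fintype ιA] (ε : ℝ)
    (ρ : Matrix (ιA × ιB) (ιA × ιB) ℂ) :
    Matrix (Option ιA × ιB) (Option ιA × ιB) ℂ :=
  fun u v =>
    match u.1, v.1 with
    | some a, some a' => ((1 : ℝ) - ε) * ρ (a, u.2) (a', v.2)
    | none, none => (ε : ℂ) * ptraceFst ρ u.2 v.2
    | _, _ => 0

open Polynomial in
/-- The entropy of a Hermitian matrix can be computed from any factorization of its
characteristic polynomial into linear factors with real roots. -/
lemma vnEntropy_of_charpoly_eq {ι κ : Type*} [Fintype ι] [DecidableEq ι] [Fintype κ]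
    {ρ : Matrix ι ι ℂ} (hρ : ρ.IsHermitian) (d : κ → ℝ)
    (h : ρ.charpoly = ∏ k, (X - C (d k : ℂ))) :
    vnEntropy ρ = ∑ k, Real.negMulLog (d k) := by
  have hroots : ρ.charpoly.roots = Finset.univ.val.map fun k => (d k : ℂ) := by
    rw [h, Polynomial.roots_prod]
    · simp
    · simp [Finset.prod_ne_zero_iff, Polynomial.X_sub_C_ne_zero]
  rw [hρ.roots_charpoly_eq_eigenvalues] at hroots
  have hsum := congrArg (fun s => (s.map fun z : ℂ => Real.negMulLog z.re).sum) hroots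
  simpa [vnEntropy, hρ, Multiset.map_map, Function.comp_def] using hsum

lemma vnEntropy_reindex {ι κ : Type*} [Fintype ι] [DecidableEq ι] [Fintype κ] [DecidableEq κ]
    {ρ : Matrix ι ι ℂ} (hρ : ρ.IsHermitian) (e : ι ≃ κ) :
    vnEntropy (reindex e e ρ) = vnEntropy ρ := by
  have hρe : (reindex e e ρ).IsHermitian := hρ.submatrix e.symm
  rw [vnEntropy_of_charpoly_eq hρe hρ.eigenvalues
      ((charpoly_reindex e ρ).trans hρ.charpoly_eq), vnEntropy, dif_pos hρ]

/-- Entropy is additive on block diagonal matrices. -/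
lemma vnEntropy_fromBlocks {m n : Type*} [Fintype m] [DecidableEq m] [Fintype n] [DecidableEq n]
    {A : Matrix m m ℂ} {D : Matrix n n ℂ} (hA : A.IsHermitian) (hD : D.IsHermitian) :
    vnEntropy (fromBlocks A 0 0 D) = vnEntropy A + vnEntropy D := by
  have hAD : (fromBlocks A 0 0 D).IsHermitian := hA.fromBlocks (by simp) hD
  rw [vnEntropy_of_charpoly_eq hAD (Sum.elim hA.eigenvalues hD.eigenvalues), vnEntropy, vnEntropy,
    dif_pos hA, dif_pos hD]
  · simp
  · simp [hA.charpoly_eq, hD.charpoly_eq]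

open Polynomial in
lemma charpoly_smul_of_isHermitian {ι : Type*} [Fintype ι] [DecidableEq ι] {ρ : Matrix ι ι ℂ}
    (hρ : ρ.IsHermitian) (c : ℝ) :
    ((c : ℂ) • ρ).charpoly = ∏ i, (X - C ((c * hρ.eigenvalues i : ℝ) : ℂ)) := by
  conv_lhs => rw [hρ.spectral_theorem, ← map_smul, Unitary.conjStarAlgAut_apply,
    charpoly_mul_comm, ← mul_assoc]
  simp [← diagonal_smul, charpoly_diagonal]

/-- Entropy of a real multiple of a trace-one Hermitian matrix. -/
lemma vnEntropy_smul {ι : Type*} [Fintype ι] [DecidableEq ι] {ρ : Matrix ι ι ℂ}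
    (hρ : ρ.IsHermitian) (htr : ρ.trace = 1) (c : ℝ) :
    vnEntropy ((c : ℂ) • ρ) = Real.negMulLog c + c * vnEntropy ρ := by
  have hc : ((c : ℂ) • ρ).IsHermitian := by
    simp [IsHermitian, conjTranspose_smul, hρ.eq]
  have hsum : ∑ i, hρ.eigenvalues i = 1 := by
    have := hρ.trace_eq_sum_eigenvalues
    rw [htr] at this
    exact Complex.ofReal_injective (by simpa using this.symm)
  rw [vnEntropy_of_charpoly_eq hc _ (charpoly_smul_of_isHermitian hρ c), vnEntropy, dif_pos hρ]
  simp [Real.negMulLog_mul, Finset.sum_add_distrib, ← Finset.sum_mul, ← Finset.mul_sum, hsum]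

open MatrixOrder Matrix.Norms.L2Operator in
lemma Matrix.PosSemidef.fromBlocks_diagonal {m n : Type*} [Fintype m] [Fintype n]
    {A : Matrix m m ℂ} {D : Matrix n n ℂ} (hA : A.PosSemidef) (hD : D.PosSemidef) :
    (fromBlocks A 0 0 D).PosSemidef := by
  classical
  obtain ⟨a, rfl⟩ := CStarAlgebra.nonneg_iff_eq_star_mul_self.mp hA.nonneg
  obtain ⟨d, rfl⟩ := CStarAlgebra.nonneg_iff_eq_star_mul_self.mp hD.nonneg
  have := posSemidef_conjTranspose_mul_self (fromBlocks a 0 0 d)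
  simpa [fromBlocks_conjTranspose, fromBlocks_multiply, star_eq_conjTranspose] using this

/-- The partial trace of a density matrix is a density matrix. -/
lemma IsDensityMatrix.ptraceFst {ιA ιB : Type*} [Fintype ιA] [Fintype ιB]
    {ρ : Matrix (ιA × ιB) (ιA × ιB) ℂ} (hρ : IsDensityMatrix ρ) :
    IsDensityMatrix (ptraceFst ρ) := by
  constructor
  · have h : _root_.ptraceFst ρ = ∑ a, ρ.submatrix (Prod.mk a) (Prod.mk a) := by
      ext b b'
      simp [_root_.ptraceFst, Matrix.sum_apply]
    rw [h]
    exact posSemidef_sum _ fun a _ => hρ.1.submatrix _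
  · rw [← hρ.2]
    simp only [trace, diag, _root_.ptraceFst, Fintype.sum_prod_type]
    exact Finset.sum_comm

/-- The output of the erasure channel is block diagonal with respect to the erasure flag. -/
lemma erasureOut_eq_reindex {ιA ιB : Type*} [Fintype ιA] (ε : ℝ)
    (ρ : Matrix (ιA × ιB) (ιA × ιB) ℂ) :
    erasureOut ε ρ = reindex optionProdEquiv.symm optionProdEquiv.symm
      (fromBlocks ((ε : ℂ) • ptraceFst ρ) 0 0 (((1 - ε : ℝ) : ℂ) • ρ)) := by
  ext ⟨_ | a, b⟩ ⟨_ | a', b'⟩ <;> simp [erasureOut]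

/-- The output of the erasure channel is a density matrix whose entropy is
`H(ε) + (1−ε) S(ρ) + ε S(ρ_B)`. -/
theorem stmt11 {ιA ιB : Type*} [Fintype ιA] [DecidableEq ιA] [Fintype ιB] [DecidableEq ιB]
    (ε : ℝ) (hε0 : 0 ≤ ε) (hε1 : ε ≤ 1)
    (ρ : Matrix (ιA × ιB) (ιA × ιB) ℂ) (hρ : IsDensityMatrix ρ) :
    IsDensityMatrix (erasureOut ε ρ) ∧
    vnEntropy (erasureOut ε ρ) =
      (Real.negMulLog ε + Real.negMulLog (1 - ε)) + (1 - ε) * vnEntropy ρ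
        + ε * vnEntropy (ptraceFst ρ) := by
  have hB := hρ.ptraceFst
  have h1 : 0 ≤ 1 - ε := sub_nonneg.mpr hε1
  have hP₁ : ((ε : ℂ) • ptraceFst ρ).PosSemidef := hB.1.smul (by exact_mod_cast hε0)
  have hP₂ : (((1 - ε : ℝ) : ℂ) • ρ).PosSemidef := hρ.1.smul (by exact_mod_cast h1)
  have hP := hP₁.fromBlocks_diagonal hP₂
  rw [erasureOut_eq_reindex]
  refine ⟨⟨hP.submatrix _, ?_⟩, ?_⟩
  · refine (Equiv.sum_comp optionProdEquiv fun i => fromBlocks ((ε : ℂ) • ptraceFst ρ) 0 0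
      (((1 - ε : ℝ) : ℂ) • ρ) i i).trans ?_
    rw [Fintype.sum_sum_type]
    change trace ((ε : ℂ) • ptraceFst ρ) + trace (((1 - ε : ℝ) : ℂ) • ρ) = 1
    rw [trace_smul, trace_smul, hB.2, hρ.2]
    simp
  · rw [vnEntropy_reindex hP.isHermitian, vnEntropy_fromBlocks hP₁.isHermitian hP₂.isHermitian,
      vnEntropy_smul hB.1.isHermitian hB.2, vnEntropy_smul hρ.1.isHermitian hρ.2]
    ring
end
end

section
/- (Random phase flips dephase a bipartite pure state in its Schmidt basis.) Let n ≥ 1, let ι_A and ι_B be finite types, let (v_y)_{y ∈ Fin n} be an orthonormal family of vectors in ℂ^{ι_A}, let (w_y)_{y ∈ Fin n} be an orthonormal family of vectors in ℂ^{ι_B}, and let λ : Fin n → ℝ with λ_y ≥ 0. Let Φ = ∑_y √(λ_y) · (v_y ⊗ w_y) ∈ ℂ^{ι_A × ι_B}, and for each sign pattern f : Fin n → Bool define the phase-flip operator F_f = ∑_y (−1)^{f(y)} · v_y v_yᴴ on ℂ^{ι_A}. Then averaging the phase-flipped states over all 2^n sign patterns yields the dephased state: (1/2^n) · ∑_{f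 : Fin n → Bool} (F_f ⊗ 1_B) (Φ Φᴴ) (F_f ⊗ 1_B)ᴴ = ∑_y λ_y · (v_y v_yᴴ) ⊗ (w_y w_yᴴ). -/
open Matrix Kronecker BigOperators ComplexOrder

noncomputable section

/-- Orthogonality of the sign characters on `ι → Bool`. -/
theorem sum_sign_mul_sign {ι : Type*} [Fintype ι] [DecidableEq ι] (y y' : ι) :
    ∑ f : ι → Bool, (if f y then (-1 : ℂ) else 1) * (if f y' then (-1 : ℂ) else 1)
      = if y = y' then 2 ^ Fintype.card ι else 0 := by
  split_ifs with h
  · subst h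
    have h1 (f : ι → Bool) :
        (if f y then (-1 : ℂ) else 1) * (if f y then (-1 : ℂ) else 1) = 1 := by
      split_ifs <;> norm_num
    simp [h1]
  · refine Finset.sum_involution (fun f _ => Function.update f y (!f y)) ?_ ?_ ?_ ?_
    · intro f _
      have h2 : y' ≠ y := Ne.symm h
      cases hf : f y <;> cases hf' : f y' <;> simp [Function.update_of_ne h2, hf']
    · intro f _ _ he
      have := congrFun he y
      simp at this
    · simp
    · intro f _
      simp

/-- A phase flip on the first factor multiplies each Schmidt coefficient by its sign. -/
theorem phaseFlip_kronecker_one_mulVec {κ ιA ιB : Type*} [Fintype κ] [DecidableEq κ]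
    [Fintype ιA] [Fintype ιB] [DecidableEq ιB]
    (v : κ → ιA → ℂ) (hv : ∀ y y', star (v y) ⬝ᵥ v y' = if y = y' then (1 : ℂ) else 0)
    (w : κ → ιB → ℂ) (c s : κ → ℂ) :
    ((∑ y, s y • vecMulVec (v y) (star (v y))) ⊗ₖ (1 : Matrix ιB ιB ℂ)) *ᵥ
        (fun p => ∑ y, c y * (v y p.1 * w y p.2))
      = fun p => ∑ y, s y * (c y * (v y p.1 * w y p.2)) := by
  have key (z : κ) (a : ιA) :
      ∑ a', (∑ y, s y • vecMulVec (v y) (star (v y))) a a' * v z a' = s z * v z a := by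
    calc _ = ((∑ y, s y • vecMulVec (v y) (star (v y))) *ᵥ v z) a := rfl
      _ = s z * v z a := by
        simp [Matrix.sum_mulVec, Matrix.smul_mulVec, Matrix.vecMulVec_mulVec, hv, Finset.sum_apply,
          apply_ite (fun u : ιA → ℂ => u a)]
  ext ⟨a, b⟩
  simp only [mulVec, dotProduct, kroneckerMap_apply, Fintype.sum_prod_type, one_apply,
    mul_ite, mul_one, mul_zero, ite_mul, zero_mul, Finset.sum_ite_eq, Finset.mem_univ, if_true]
  simp only [Finset.mul_sum]
  rw [Finset.sum_comm]
  refine Finset.sum_congr rfl fun z _ => ?_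
  calc _ = c z * w z b *
        ∑ a', (∑ y, s y • vecMulVec (v y) (star (v y))) a a' * v z a' := by
        rw [Finset.mul_sum]
        exact Finset.sum_congr rfl fun _ _ => by ring
    _ = _ := by rw [key]; ring

/-- Averaging over all `2^n` random phase flips in the Schmidt basis dephases a bipartite
pure state to the corresponding classically correlated (dephased) state. -/
theorem stmt14 (n : ℕ) (hn : 1 ≤ n) {ιA ιB : Type*}
    [Fintype ιA] [DecidableEq ιA] [Fintype ιB] [DecidableEq ιB]
    (v : Fin n → ιA → ℂ)
    (hv : ∀ y y', star (v y) ⬝ᵥ v y' = if y = y' then (1 : ℂ) else 0)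
    (w : Fin n → ιB → ℂ)
    (hw : ∀ y y', star (w y) ⬝ᵥ w y' = if y = y' then (1 : ℂ) else 0)
    (lam : Fin n → ℝ) (hlam : ∀ y, 0 ≤ lam y)
    (Φ : (ιA × ιB) → ℂ)
    (hΦ : Φ = fun p => ∑ y, (Real.sqrt (lam y) : ℂ) * (v y p.1 * w y p.2))
    (F : (Fin n → Bool) → Matrix ιA ιA ℂ)
    (hF : ∀ f, F f = ∑ y, (if f y then (-1 : ℂ) else 1) •
      Matrix.vecMulVec (v y) (star (v y))) :
    (1 / (2 ^ n : ℂ)) •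
        ∑ f : Fin n → Bool,
          (F f ⊗ₖ (1 : Matrix ιB ιB ℂ)) * Matrix.vecMulVec Φ (star Φ) *
            (F f ⊗ₖ (1 : Matrix ιB ιB ℂ))ᴴ
      = ∑ y, ((lam y : ℝ) : ℂ) •
          (Matrix.vecMulVec (v y) (star (v y)) ⊗ₖ Matrix.vecMulVec (w y) (star (w y))) := by
  have conj (f : Fin n → Bool) :
      (F f ⊗ₖ (1 : Matrix ιB ιB ℂ)) * vecMulVec Φ (star Φ) * (F f ⊗ₖ (1 : Matrix ιB ιB ℂ))ᴴ
        = vecMulVec ((F f ⊗ₖ (1 : Matrix ιB ιB ℂ)) *ᵥ Φ)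
            (star ((F f ⊗ₖ (1 : Matrix ιB ιB ℂ)) *ᵥ Φ)) := by
    rw [mul_vecMulVec, vecMulVec_mul, star_mulVec]
  rw [Finset.sum_congr rfl fun f _ => conj f]
  simp only [hF, hΦ, phaseFlip_kronecker_one_mulVec v hv w]
  ext ⟨a, b⟩ ⟨a', b'⟩
  simp only [Matrix.smul_apply, Matrix.sum_apply, vecMulVec_apply, kroneckerMap_apply, Pi.star_apply,
    star_sum, star_mul', smul_eq_mul]
  have star_sign (f : Fin n → Bool) (y : Fin n) :
      star (if f y then (-1 : ℂ) else 1) = if f y then (-1 : ℂ) else 1 := by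
    split_ifs <;> simp
  have hsq (y : Fin n) : (√(lam y) : ℂ) * star (√(lam y) : ℂ) = lam y := by
    simp only [Complex.star_def, Complex.conj_ofReal]
    rw [← Complex.ofReal_mul, Real.mul_self_sqrt (hlam y)]
  let t (y : Fin n) (a : ιA) (b : ιB) : ℂ := (√(lam y) : ℂ) * (v y a * w y b)
  calc _ = 1 / 2 ^ n * ∑ y, ∑ y', t y a b * star (t y' a' b') *
        ∑ f : Fin n → Bool, (if f y then (-1 : ℂ) else 1) * (if f y' then (-1 : ℂ) else 1) := by
        congr 1
        simp only [star_sign, Finset.sum_mul_sum]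
        simp only [Finset.mul_sum]
        rw [Finset.sum_comm]
        refine Finset.sum_congr rfl fun y _ => ?_
        rw [Finset.sum_comm]
        refine Finset.sum_congr rfl fun y' _ => Finset.sum_congr rfl fun f _ => ?_
        simp only [t, star_mul']
        ring
    _ = ∑ y, t y a b * star (t y a' b') := by
        simp only [sum_sign_mul_sign]
        simp only [Fintype.card_fin, mul_ite, mul_zero, Finset.sum_ite_eq,
          Finset.mem_univ, if_true]
        rw [← Finset.sum_mul]
        field_simp
    _ = _ := by
        refine Finset.sum_congr rfl fun y _ => ?_
        rw [← hsq y]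
        simp only [t, star_mul']
        ring
end
end
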